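/- Let m, q ∈ ℂ with m ≠ 0, and let w(x) = (m/x)·(1 − q/x + u(x)) where u is twice differentiable on a domain avoiding 0. If w satisfies the equation w'' = ((3w−1)/(2w(w−1)))·(w')² − w'/x + α w(w−1)²/x² − (m²/2)·(w−1)²/(x² w) + (q−2m)·w/x − (1/2)·w(w+1)/(w−1) (i.e., P_V with β = −m²/2, γ = q − 2m, δ = −1/2), then u satisfies an equation of the form u'' = (1 + 2q/x)·u + f(1/x, u, u'), where f(s, a, b) is analytic in a neighborhood of (0,0,0) and f = O(s²) + O(a²) + O(b²) + O(ab), i.e., f(0,0,0) = 0, ∂f/∂s(0,0,0) = 0, ∂f/∂a(0,0,0) = 0, ∂f/∂b(0,0,0) = 0, and the pure s-part of f vanishes to second order. -/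

import Mathlib

/-- The residual term of the normalized Painlevé V equation, written in terms of
`s = 1 / x`, `a = u`, `b = u'`. -/
noncomputable def normalizedResidual (α m q s a b : ℂ) : ℂ :=
  (3 * (m * s * (1 - q * s + a)) - 1) * (q * s ^ 2 + b - s * (1 - q * s + a)) ^ 2
      / (2 * (1 - q * s + a) * (m * s * (1 - q * s + a) - 1))
    + s * (q * s ^ 2 + b) - s ^ 2 * (1 - q * s + a)
    + α * (1 - q * s + a) * (m * s * (1 - q * s + a) - 1) ^ 2 * s ^ 2
    - (1 / 2) * (m * s * (1 - q * s + a) - 1) ^ 2 / (1 - q * s + a)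
    + (q - 2 * m) * (1 - q * s + a) * s
    - (1 / 2) * (1 - q * s + a) * (m * s * (1 - q * s + a) + 1) / (m * s * (1 - q * s + a) - 1)
    + 2 * q * s ^ 3 - (1 + 2 * q * s) * a

theorem AnalyticAt.normalizedResidual {E : Type*} [NormedAddCommGroup E] [NormedSpace ℂ E]
    (α m q : ℂ) {s a b : E → ℂ} {p : E} (hs : AnalyticAt ℂ s p) (ha : AnalyticAt ℂ a p)
    (hb : AnalyticAt ℂ b p) (hv : 1 - q * s p + a p ≠ 0)
    (hw : m * s p * (1 - q * s p + a p) - 1 ≠ 0) :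
    AnalyticAt ℂ (fun p => normalizedResidual α m q (s p) (a p) (b p)) p := by
  unfold _root_.normalizedResidual
  fun_prop (disch := simp [hv, hw])

theorem normalizedResidual_zero (α m q : ℂ) : normalizedResidual α m q 0 0 0 = 0 := by
  norm_num [normalizedResidual]

theorem deriv_normalizedResidual_fst (α m q : ℂ) :
    deriv (fun s => normalizedResidual α m q s 0 0) 0 = 0 := by
  have hs : HasDerivAt (fun s : ℂ => s) 1 0 := hasDerivAt_id 0
  have hv : HasDerivAt (fun s : ℂ => 1 - q * s + 0) (-q) 0 := by
    simpa using ((hs.const_mul q).const_sub 1).add_const 0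
  have hw : HasDerivAt (fun s : ℂ => m * s * (1 - q * s + 0)) m 0 := by
    exact ((hs.const_mul m).mul hv).congr_deriv (by simp)
  have hv' : HasDerivAt (fun s : ℂ => q * s ^ 2 + 0) 0 0 := by
    simpa using ((hs.pow 2).const_mul q).add_const 0
  have h1 := (((hw.const_mul 3).sub_const 1).mul ((hv'.sub (hs.mul hv)).pow 2)).div
    ((hv.const_mul 2).mul (hw.sub_const 1)) (by simp)
  have h2 := (hs.mul hv')
  have h3 := (hs.pow 2).mul hv
  have h4 := ((hv.const_mul α).mul ((hw.sub_const 1).pow 2)).mul (hs.pow 2)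
  have h5 := (((hw.sub_const 1).pow 2).const_mul (1 / 2)).div hv (by simp)
  have h6 := (hv.const_mul (q - 2 * m)).mul hs
  have h7 := ((hv.const_mul (1 / 2)).mul (hw.add_const 1)).div (hw.sub_const 1) (by simp)
  have h8 := (hs.pow 3).const_mul (2 * q)
  have h9 := ((hs.const_mul (2 * q)).const_add 1).mul_const 0
  have h := (((((((h1.add h2).sub h3).add h4).sub h5).add h6).sub h7).add h8).sub h9
  refine (h.congr_deriv ?_).deriv
  simp
  ring

theorem deriv_normalizedResidual_snd (α m q : ℂ) :
    deriv (fun a => normalizedResidual α m q 0 a 0) 0 = 0 := by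
  have ha : HasDerivAt (fun a : ℂ => a) 1 0 := hasDerivAt_id 0
  have hv : HasDerivAt (fun a : ℂ => 1 + a) 1 0 := ha.const_add 1
  have h := (((hv.inv (by simp)).const_mul (-(1 / 2) : ℂ)).add (hv.const_mul (1 / 2))).sub ha
  have hf : (fun a => normalizedResidual α m q 0 a 0) =
      fun a : ℂ => -(1 / 2) * (1 + a)⁻¹ + (1 / 2) * (1 + a) - a := by
    funext a
    simp [normalizedResidual]
    ring
  rw [hf]
  refine (h.congr_deriv ?_).deriv
  norm_num

theorem deriv_normalizedResidual_trd (α m q : ℂ) :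
    deriv (fun b => normalizedResidual α m q 0 0 b) 0 = 0 := by
  have hf : (fun b => normalizedResidual α m q 0 0 b) = fun b : ℂ => (1 / 2) * b ^ 2 := by
    funext b
    simp [normalizedResidual]
    ring
  rw [hf]
  simp

/-- First derivative of `w = (m / x) (1 - q / x + u)`. -/
theorem hasDerivAt_normalization (m q : ℂ) {u : ℂ → ℂ} {u' x : ℂ} (hx : x ≠ 0)
    (hu : HasDerivAt u u' x) :
    HasDerivAt (fun y => (m / y) * (1 - q / y + u y))
      (m / x * (q / x ^ 2 + u') - m / x ^ 2 * (1 - q / x + u x)) x := by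
  have hi (c : ℂ) : HasDerivAt (fun y : ℂ => c / y) (-c / x ^ 2) x := by
    exact ((hasDerivAt_const x c).div (hasDerivAt_id x) hx).congr_deriv (by simp)
  refine ((hi m).mul (((hi q).const_sub 1).add hu)).congr_deriv ?_
  simp only [Pi.add_apply]
  ring

/-- Second derivative of `w = (m / x) (1 - q / x + u)`. -/
theorem hasDerivAt_deriv_normalization (m q : ℂ) {u u' : ℂ → ℂ} {u'' x : ℂ} (hx : x ≠ 0)
    (hu : HasDerivAt u (u' x) x) (hu' : HasDerivAt u' u'' x) :
    HasDerivAt (fun y => m / y * (q / y ^ 2 + u' y) - m / y ^ 2 * (1 - q / y + u y))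
      (m / x * (u'' - 2 * q / x ^ 3) - 2 * m / x ^ 2 * (q / x ^ 2 + u' x)
        + 2 * m / x ^ 3 * (1 - q / x + u x)) x := by
  have hi (c : ℂ) : HasDerivAt (fun y : ℂ => c / y) (-c / x ^ 2) x := by
    exact ((hasDerivAt_const x c).div (hasDerivAt_id x) hx).congr_deriv (by simp)
  have hi2 (c : ℂ) : HasDerivAt (fun y : ℂ => c / y ^ 2) (-2 * c / x ^ 3) x := by
    refine ((hasDerivAt_const x c).div (hasDerivAt_pow 2 x) (pow_ne_zero 2 hx)).congr_deriv ?_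
    field_simp
    norm_num
    ring
  refine (((hi m).mul ((hi2 q).add hu')).sub
    ((hi2 m).mul (((hi q).const_sub 1).add hu))).congr_deriv ?_
  simp only [Pi.add_apply]
  field_simp
  ring

/-- Solving the substituted Painlevé V equation for the second derivative of `u`. -/
theorem eq_add_normalizedResidual (α m q : ℂ) {s v a b c : ℂ} (hm : m ≠ 0) (hs : s ≠ 0)
    (hv : v = 1 - q * s + a) (hv0 : v ≠ 0) (hw1 : m * s * v - 1 ≠ 0)
    (h : m * s * (c - 2 * q * s ^ 3) - 2 * m * s ^ 2 * (q * s ^ 2 + b) + 2 * m * s ^ 3 * v =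
      ((3 * (m * s * v) - 1) / (2 * (m * s * v) * (m * s * v - 1))) *
          (m * s * (q * s ^ 2 + b) - m * s ^ 2 * v) ^ 2
        - (m * s * (q * s ^ 2 + b) - m * s ^ 2 * v) * s
        + α * (m * s * v) * (m * s * v - 1) ^ 2 * s ^ 2
        - (m ^ 2 / 2) * (m * s * v - 1) ^ 2 * s ^ 2 / (m * s * v)
        + (q - 2 * m) * (m * s * v) * s
        - (1 / 2) * (m * s * v) * (m * s * v + 1) / (m * s * v - 1)) :
    c = (1 + 2 * q * s) * a + normalizedResidual α m q s a b := by
  unfold normalizedResidual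
  rw [← hv]
  have hms : m * s ≠ 0 := mul_ne_zero hm hs
  apply mul_left_cancel₀ hms
  have e1 : ((3 * (m * s * v) - 1) / (2 * (m * s * v) * (m * s * v - 1))) *
      (m * s * (q * s ^ 2 + b) - m * s ^ 2 * v) ^ 2 = m * s * ((3 * (m * s * v) - 1) *
        (q * s ^ 2 + b - s * v) ^ 2 / (2 * v * (m * s * v - 1))) := by
    field_simp
  have e2 : (m ^ 2 / 2) * (m * s * v - 1) ^ 2 * s ^ 2 / (m * s * v) =
      m * s * ((1 / 2) * (m * s * v - 1) ^ 2 / v) := by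
    field_simp
  rw [e1, e2] at h
  linear_combination h

/-- Normalization of P_V in the family I₀: if `w = (m/x)(1 − q/x + u)` satisfies
`w'' = ((3w−1)/(2w(w−1)))w'² − w'/x + αw(w−1)²/x² − (m²/2)(w−1)²/(x²w) + (q−2m)w/x
 − (1/2)w(w+1)/(w−1)` on an open set `U` avoiding `0` (with `w ∉ {0,1}`), then `u` satisfies
`u'' = (1 + 2q/x)u + f(1/x, u, u')` where `f` is analytic near `(0,0,0)`,
`f(0,0,0) = 0`, and all first partial derivatives of `f` vanish at the origin
(so `f = O(s²) + O(a²) + O(b²) + O(ab)`). -/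
theorem stmt15 (α m q : ℂ) (hm : m ≠ 0) (U : Set ℂ) (hU : IsOpen U)
    (u w : ℂ → ℂ) (hw : ∀ x ∈ U, w x = (m / x) * (1 - q / x + u x))
    (hu : AnalyticOn ℂ u U)
    (h0 : ∀ x ∈ U, x ≠ 0) (hwz : ∀ x ∈ U, w x ≠ 0) (hw1 : ∀ x ∈ U, w x ≠ 1)
    (heq : ∀ x ∈ U,
      deriv (deriv w) x =
        ((3 * w x - 1) / (2 * w x * (w x - 1))) * (deriv w x) ^ 2 - deriv w x / x
          + α * w x * (w x - 1) ^ 2 / x ^ 2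
          - (m ^ 2 / 2) * (w x - 1) ^ 2 / (x ^ 2 * w x)
          + (q - 2 * m) * w x / x
          - (1 / 2) * w x * (w x + 1) / (w x - 1)) :
    ∃ f : ℂ → ℂ → ℂ → ℂ,
      AnalyticAt ℂ (fun p : ℂ × ℂ × ℂ => f p.1 p.2.1 p.2.2) (0, 0, 0) ∧
      f 0 0 0 = 0 ∧
      deriv (fun s => f s 0 0) 0 = 0 ∧
      deriv (fun a => f 0 a 0) 0 = 0 ∧
      deriv (fun b => f 0 0 b) 0 = 0 ∧
      ∀ x ∈ U, deriv (deriv u) x = (1 + 2 * q / x) * u x + f (1 / x) (u x) (deriv u x) := by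
  refine ⟨normalizedResidual α m q, analyticAt_fst.normalizedResidual α m q
      (analyticAt_fst.comp analyticAt_snd) (analyticAt_snd.comp analyticAt_snd)
      (by simp) (by simp),
    normalizedResidual_zero α m q, deriv_normalizedResidual_fst α m q,
    deriv_normalizedResidual_snd α m q, deriv_normalizedResidual_trd α m q, fun x hx => ?_⟩
  have hd : ∀ y ∈ U, HasDerivAt u (deriv u y) y ∧
      HasDerivAt (deriv u) (deriv (deriv u) y) y := fun y hy =>
    have ha : AnalyticAt ℂ u y := (hU.analyticOn_iff_analyticOnNhd.mp hu) y hy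
    ⟨ha.differentiableAt.hasDerivAt, ha.deriv.differentiableAt.hasDerivAt⟩
  have hdw : ∀ y ∈ U, deriv w y =
      m / y * (q / y ^ 2 + deriv u y) - m / y ^ 2 * (1 - q / y + u y) := fun y hy =>
    ((hasDerivAt_normalization m q (h0 y hy) (hd y hy).1).congr_of_eventuallyEq
      (Filter.eventually_of_mem (hU.mem_nhds hy) hw)).deriv
  have hddw := ((hasDerivAt_deriv_normalization m q (h0 x hx) (hd x hx).1
    (hd x hx).2).congr_of_eventuallyEq (Filter.eventually_of_mem (hU.mem_nhds hx) hdw)).deriv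
  have hx0 := h0 x hx
  have hwx : w x = m * (1 / x) * (1 - q * (1 / x) + u x) := by
    rw [hw x hx]
    ring
  have hwz' := hwz x hx
  have hw1' := sub_ne_zero.mpr (hw1 x hx)
  have he := heq x hx
  rw [hddw, hdw x hx, hwx, ← div_div _ (x ^ 2)] at he
  rw [hwx] at hwz' hw1'
  have key := eq_add_normalizedResidual α m q (c := deriv (deriv u) x) (b := deriv u x) hm
    (one_div_ne_zero hx0) rfl (right_ne_zero_of_mul hwz') hw1'
    (by linear_combination he)
  rw [key]
  ring
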